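/- For the fractional Gaussian noise with Hurst index H ∈ (0,1) and every n ≥ 1, det Σ_n(H) ≥ (σ²_H)^n, where σ²_H = Γ(3/2 − H)/(Γ(H + 1/2) Γ(2 − 2H)); equivalently, the entropy of (G^H_1,…,G^H_n), given by H(G^H_1,…,G^H_n) = (n/2)(1 + log(2π)) + (1/2) log det Σ_n(H), satisfies H(G^H_1,…,G^H_n) ≥ (n/2)(1 + log(2π) + log σ²_H). -/

import Mathlib

open Real Matrix Filter Topology

/-- Autocovariance of fractional Gaussian noise with Hurst index `H`. -/
noncomputable def fgnRho (H : ℝ) (k : ℕ) : ℝ :=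
  if k = 0 then 1
  else (((k : ℝ) + 1) ^ (2 * H) - 2 * (k : ℝ) ^ (2 * H) + ((k : ℝ) - 1) ^ (2 * H)) / 2

/-- Covariance matrix of `n` consecutive values of fractional Gaussian noise. -/
noncomputable def fgnCov (H : ℝ) (n : ℕ) : Matrix (Fin n) (Fin n) ℝ :=
  Matrix.of fun i j => fgnRho H (Nat.dist i.val j.val)

/-- The lower bound `σ²_H = Γ(3/2 − H) / (Γ(H + 1/2) Γ(2 − 2H))`. -/
noncomputable def fgnSigmaSq (H : ℝ) : ℝ :=
  Real.Gamma (3 / 2 - H) / (Real.Gamma (H + 1 / 2) * Real.Gamma (2 - 2 * H))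

section

open MeasureTheory Set

theorem image_div_one_sub_Ioo : (fun u : ℝ => u / (1 - u)) '' Ioo 0 1 = Ioi 0 := by
  ext s
  simp only [mem_image, mem_Ioo, mem_Ioi]
  constructor
  · rintro ⟨u, ⟨h0, h1⟩, rfl⟩
    exact div_pos h0 (sub_pos.2 h1)
  · intro hs
    have h1 : 0 < 1 + s := by linarith
    refine ⟨s / (1 + s), ⟨by positivity, by rw [div_lt_one h1]; linarith⟩, ?_⟩
    field_simp
    ring

theorem integral_Ioo_rpow_mul_one_sub_rpow {x y : ℝ} (hx : 0 < x) (hy : 0 < y) :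
    ∫ u in Ioo (0 : ℝ) 1, u ^ (x - 1) * (1 - u) ^ (y - 1) = ProbabilityTheory.beta x y := by
  have h := ProbabilityTheory.lintegral_betaPDF_eq_one hx hy
  have hb := ProbabilityTheory.beta_pos hx hy
  rw [ProbabilityTheory.lintegral_betaPDF] at h
  have h2 : ∫ u in Ioo (0 : ℝ) 1,
      1 / ProbabilityTheory.beta x y * u ^ (x - 1) * (1 - u) ^ (y - 1) = 1 := by
    rw [integral_eq_lintegral_of_nonneg_ae, h, ENNReal.toReal_one]
    · refine ae_restrict_of_forall_mem measurableSet_Ioo fun u hu => ?_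
      have h1 : 0 < 1 - u := sub_pos.2 hu.2
      have h0 : 0 < u := hu.1
      simp only [Pi.zero_apply]
      positivity
    · exact Measurable.aestronglyMeasurable (by fun_prop)
  simp_rw [mul_assoc, integral_const_mul] at h2
  field_simp at h2
  exact h2

/-- The beta integral over the half line. -/
theorem integral_Ioi_rpow_mul_one_add_rpow {x y : ℝ} (hx : 0 < x) (hy : 0 < y) :
    ∫ s in Ioi (0 : ℝ), s ^ (x - 1) * (1 + s) ^ (-(x + y)) = ProbabilityTheory.beta x y := by
  rw [← image_div_one_sub_Ioo, integral_image_eq_integral_abs_deriv_smul measurableSet_Ioo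
    (f' := fun u => 1 / (1 - u) ^ 2), ← integral_Ioo_rpow_mul_one_sub_rpow hx hy]
  · refine setIntegral_congr_fun measurableSet_Ioo fun u ⟨h0, h1⟩ => ?_
    have h2 : 0 < 1 - u := sub_pos.2 h1
    have h3 : 1 + u / (1 - u) = (1 - u)⁻¹ := by field_simp; ring
    have h4 : 1 / (1 - u) ^ 2 = (1 - u) ^ (-2 : ℝ) := by
      rw [rpow_neg h2.le, one_div]; norm_cast
    simp only [smul_eq_mul]
    rw [abs_of_pos (by positivity), h3, h4, div_rpow h0.le h2.le, inv_rpow h2.le, ← rpow_neg h2.le,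
      neg_neg, div_eq_mul_inv, ← rpow_neg h2.le,
      show y - 1 = -2 + -(x - 1) + (x + y) by ring,
      rpow_add h2 (-2 + -(x - 1)) (x + y), rpow_add h2 (-2) (-(x - 1))]
    ring
  · intro u ⟨h0, h1⟩
    have h2 : 1 - u ≠ 0 := (sub_pos.2 h1).ne'
    have := ((hasDerivAt_id u).div ((hasDerivAt_id u).const_sub 1) h2).hasDerivWithinAt
      (s := Ioo 0 1)
    refine this.congr_deriv ?_
    simp
  · intro u hu v hv huv
    have h2 : 1 - u ≠ 0 := (sub_pos.2 hu.2).ne'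
    have h3 : 1 - v ≠ 0 := (sub_pos.2 hv.2).ne'
    simp only at huv
    field_simp at huv
    linarith

theorem integrableOn_Ioi_rpow_mul_one_add_rpow {x y : ℝ} (hx : 0 < x) (hy : 0 < y) :
    IntegrableOn (fun s : ℝ => s ^ (x - 1) * (1 + s) ^ (-(x + y))) (Ioi 0) := by
  by_contra h
  have := integral_Ioi_rpow_mul_one_add_rpow hx hy
  rw [integral_undef h] at this
  exact (ProbabilityTheory.beta_pos hx hy).ne this

theorem tendsto_mul_one_add_inv_rpow_sub_one (c : ℝ) :
    Tendsto (fun s : ℝ => s * ((1 + s⁻¹) ^ c - 1)) atTop (𝓝 c) := by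
  have h : HasDerivAt (fun x : ℝ => x ^ c) c 1 := by
    simpa using hasDerivAt_rpow_const (x := 1) (p := c) (Or.inl one_ne_zero)
  have h2 := (hasDerivAt_iff_tendsto_slope_zero.1 h).comp
    (tendsto_inv_atTop_nhdsGT_zero.mono_right (nhdsWithin_mono _ fun x hx => ne_of_gt hx))
  simpa [Function.comp_def] using h2

/-- A primitive of `(1 + 2 a) ((1 + s) ^ a - s ^ a) ^ 2 - (1 - a) s ^ a (1 + s) ^ (a - 2)`. -/
noncomputable def powerDiffPrimitive (a s : ℝ) : ℝ :=
  s * ((1 + s) ^ a - s ^ a) ^ 2 + (1 + s) ^ (2 * a) - s ^ (a + 1) * (1 + s) ^ (a - 1)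

theorem hasDerivAt_powerDiffPrimitive (a : ℝ) {s : ℝ} (hs : 0 < s) :
    HasDerivAt (powerDiffPrimitive a)
      ((1 + 2 * a) * ((1 + s) ^ a - s ^ a) ^ 2 - (1 - a) * (s ^ a * (1 + s) ^ (a - 2))) s := by
  have h1 : 0 < 1 + s := by linarith
  have hd (c : ℝ) : HasDerivAt (fun x : ℝ => x ^ c) (c * s ^ (c - 1)) s :=
    hasDerivAt_rpow_const (Or.inl hs.ne')
  have he (c : ℝ) : HasDerivAt (fun x : ℝ => (1 + x) ^ c) (c * (1 + s) ^ (c - 1)) s := by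
    simpa [mul_comm] using ((hasDerivAt_id s).const_add 1).rpow_const (p := c) (Or.inl h1.ne')
  have := (((hasDerivAt_id s).mul (((he a).sub (hd a)).pow 2)).add (he (2 * a))).sub
    ((hd (a + 1)).mul (he (a - 1)))
  refine this.congr_deriv ?_
  have e1 : s ^ (a - 1) = s ^ a / s := rpow_sub_one hs.ne' _
  have e2 : (1 + s) ^ (a - 1) = (1 + s) ^ a / (1 + s) := rpow_sub_one h1.ne' _
  have e3 : s ^ (a + 1) = s ^ a * s := rpow_add_one hs.ne' _
  have e4 : (1 + s) ^ (a - 2) = (1 + s) ^ a / (1 + s) ^ 2 := by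
    rw [rpow_sub h1]; norm_cast
  have e5 : (1 + s) ^ (2 * a - 1) = (1 + s) ^ a * (1 + s) ^ a / (1 + s) := by
    rw [rpow_sub_one h1.ne', two_mul, rpow_add h1]
  have e6 : (1 + s) ^ (a - 1 - 1) = (1 + s) ^ a / (1 + s) ^ 2 := by
    rw [← e4]; ring_nf
  simp only [id, Pi.sub_apply, Pi.pow_apply, add_sub_cancel_right, e6, e5, e4, e3, e2, e1]
  field_simp
  ring

theorem powerDiffPrimitive_eq (a : ℝ) {s : ℝ} (hs : 0 < s) :
    powerDiffPrimitive a s = s ^ (2 * a - 1) * ((s * ((1 + s⁻¹) ^ a - 1)) ^ 2 +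
      (1 + s⁻¹) ^ (a - 1) * (s * ((1 + s⁻¹) ^ (a + 1) - 1))) := by
  have h1 : 0 < 1 + s := by linarith
  have h2 : 0 < 1 + s⁻¹ := by positivity
  have h3 : 1 + s = s * (1 + s⁻¹) := by field_simp; ring
  have e1 (c : ℝ) : (1 + s) ^ c = s ^ c * (1 + s⁻¹) ^ c := by rw [h3, mul_rpow hs.le h2.le]
  simp only [powerDiffPrimitive, e1, rpow_add_one hs.ne', rpow_add_one h2.ne',
    rpow_sub_one hs.ne', rpow_sub_one h2.ne', two_mul, rpow_add hs, rpow_add h2]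
  field_simp
  ring

theorem tendsto_powerDiffPrimitive_atTop {a : ℝ} (ha : a < 1 / 2) :
    Tendsto (powerDiffPrimitive a) atTop (𝓝 0) := by
  have h1 : Tendsto (fun s : ℝ => s ^ (2 * a - 1)) atTop (𝓝 0) := by
    have := tendsto_rpow_neg_atTop (y := 1 - 2 * a) (by linarith)
    simpa using this
  have h2 : Tendsto (fun s : ℝ => (1 + s⁻¹) ^ (a - 1)) atTop (𝓝 1) := by
    have : Tendsto (fun s : ℝ => 1 + s⁻¹) atTop (𝓝 1) := by
      simpa using tendsto_inv_atTop_zero.const_add (1 : ℝ)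
    simpa using this.rpow_const (p := a - 1) (Or.inl one_ne_zero)
  have h3 := h1.mul (((tendsto_mul_one_add_inv_rpow_sub_one a).pow 2).add
    (h2.mul (tendsto_mul_one_add_inv_rpow_sub_one (a + 1))))
  rw [zero_mul] at h3
  refine h3.congr' ?_
  filter_upwards [eventually_gt_atTop 0] with s hs
  exact (powerDiffPrimitive_eq a hs).symm

theorem powerDiffPrimitive_zero {a : ℝ} (ha : -(1 / 2) < a) : powerDiffPrimitive a 0 = 1 := by
  simp [powerDiffPrimitive, zero_rpow (show a + 1 ≠ 0 by linarith)]

theorem continuousWithinAt_powerDiffPrimitive {a : ℝ} (ha : -(1 / 2) < a) :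
    ContinuousWithinAt (powerDiffPrimitive a) (Ici 0) 0 := by
  have h1 (c : ℝ) : ContinuousAt (fun s : ℝ => (1 + s) ^ c) 0 :=
    (continuousAt_const.add continuousAt_id).rpow_const (by simp)
  have h2 {c : ℝ} (hc : 0 < c) : ContinuousAt (fun s : ℝ => s ^ c) 0 :=
    continuousAt_id.rpow_const (Or.inr hc.le)
  have h : ContinuousAt (fun s : ℝ => s * ((1 + s) ^ a) ^ 2 - 2 * (1 + s) ^ a * s ^ (a + 1)
      + s ^ (2 * a + 1) + (1 + s) ^ (2 * a) - s ^ (a + 1) * (1 + s) ^ (a - 1)) 0 :=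
    ((((continuousAt_id.mul ((h1 a).pow 2)).sub ((continuousAt_const.mul (h1 a)).mul
      (h2 (by linarith)))).add (h2 (by linarith))).add (h1 _)).sub
      ((h2 (by linarith)).mul (h1 _))
  refine h.continuousWithinAt.congr (fun s hs => ?_) ?_
  · rcases (mem_Ici.1 hs).eq_or_lt with rfl | hs
    · simp [powerDiffPrimitive, zero_rpow (show a + 1 ≠ 0 by linarith),
        zero_rpow (show 2 * a + 1 ≠ 0 by linarith)]
    · simp only [powerDiffPrimitive, rpow_add_one hs.ne', two_mul a, rpow_add hs]
      ring
  · simp [powerDiffPrimitive, zero_rpow (show a + 1 ≠ 0 by linarith),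
        zero_rpow (show 2 * a + 1 ≠ 0 by linarith)]

theorem integrableOn_and_integral_rpow_sub_rpow_sq {a : ℝ} (ha : -(1 / 2) < a) (ha' : a < 1 / 2) :
    IntegrableOn (fun s : ℝ => ((1 + s) ^ a - s ^ a) ^ 2) (Ioi 0) ∧
    (2 * a + 1) * ∫ s in Ioi (0 : ℝ), ((1 + s) ^ a - s ^ a) ^ 2 =
      Gamma (a + 1) * Gamma (1 - 2 * a) / Gamma (1 - a) - 1 := by
  have hx : 0 < a + 1 := by linarith
  have hy : 0 < 1 - 2 * a := by linarith
  have hw : IntegrableOn (fun s : ℝ => s ^ a * (1 + s) ^ (a - 2)) (Ioi 0) ∧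
      ∫ s in Ioi (0 : ℝ), s ^ a * (1 + s) ^ (a - 2) =
        ProbabilityTheory.beta (a + 1) (1 - 2 * a) := by
    have h1 := integrableOn_Ioi_rpow_mul_one_add_rpow hx hy
    have h2 := integral_Ioi_rpow_mul_one_add_rpow hx hy
    rw [show -(a + 1 + (1 - 2 * a)) = a - 2 by ring, add_sub_cancel_right] at h1 h2
    exact ⟨h1, h2⟩
  obtain ⟨hwi, hwv⟩ := hw
  set w : ℝ → ℝ := fun s => s ^ a * (1 + s) ^ (a - 2) with hwdef
  set W : ℝ → ℝ := fun x => ∫ s in (0 : ℝ)..x, w s with hW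
  have hwint (x : ℝ) (hx : 0 ≤ x) : IntervalIntegrable w volume 0 x := by
    rw [intervalIntegrable_iff_integrableOn_Ioc_of_le hx]
    exact hwi.mono_set Ioc_subset_Ioi_self
  have hWd (x : ℝ) (hx : 0 < x) : HasDerivAt W (w x) x := by
    have hc : ContinuousOn w (Ioi 0) := by
      intro s hs
      have hs : 0 < s := hs
      exact ((continuousAt_id.rpow_const (Or.inl hs.ne')).mul
        ((continuousAt_const.add continuousAt_id).rpow_const
          (Or.inl (by change 1 + s ≠ 0; linarith)))).continuousWithinAt
    exact intervalIntegral.integral_hasDerivAt_right (hwint x hx.le)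
      (hc.stronglyMeasurableAtFilter isOpen_Ioi x hx) (hc.continuousAt (Ioi_mem_nhds hx))
  have hWc : ContinuousWithinAt W (Ici 0) 0 := by
    have h := intervalIntegral.continuousOn_primitive_interval (μ := volume) (f := w) (a := 0)
      (b := 1) (by
        rw [uIcc_of_le zero_le_one, integrableOn_Icc_iff_integrableOn_Ioc]
        exact hwi.mono_set Ioc_subset_Ioi_self)
    rw [uIcc_of_le zero_le_one] at h
    exact (h 0 (by simp)).mono_of_mem_nhdsWithin (Icc_mem_nhdsGE zero_lt_one)
  have hWt : Tendsto W atTop (𝓝 (ProbabilityTheory.beta (a + 1) (1 - 2 * a))) := by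
    rw [← hwv]
    exact intervalIntegral_tendsto_integral_Ioi 0 hwi tendsto_id
  have hc : ContinuousWithinAt (fun s => powerDiffPrimitive a s + (1 - a) * W s) (Ici 0) 0 :=
    (continuousWithinAt_powerDiffPrimitive ha).add (continuousWithinAt_const.mul hWc)
  have hd (s : ℝ) (hs : s ∈ Ioi (0 : ℝ)) :
      HasDerivAt (fun s => powerDiffPrimitive a s + (1 - a) * W s)
        ((2 * a + 1) * ((1 + s) ^ a - s ^ a) ^ 2) s := by
    refine ((hasDerivAt_powerDiffPrimitive a hs).add ((hWd s hs).const_mul _)).congr_deriv ?_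
    simp only [hwdef]
    ring
  have ht := (tendsto_powerDiffPrimitive_atTop ha').add (hWt.const_mul (1 - a))
  have h0 : ∀ s ∈ Ioi (0 : ℝ), 0 ≤ (2 * a + 1) * ((1 + s) ^ a - s ^ a) ^ 2 := fun s _ =>
    mul_nonneg (by linarith) (sq_nonneg _)
  have hi := integrableOn_Ioi_deriv_of_nonneg hc hd h0 ht
  have hv := integral_Ioi_of_hasDerivAt_of_nonneg hc hd h0 ht
  constructor
  · have := hi.const_mul (2 * a + 1)⁻¹
    refine this.congr (ae_of_all _ fun s => ?_)
    have : 2 * a + 1 ≠ 0 := by linarith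
    field_simp
  · rw [integral_const_mul] at hv
    rw [hv, powerDiffPrimitive_zero ha]
    have h1a : 0 < 1 - a := by linarith
    have hG : Gamma (a + 1 + (1 - 2 * a)) = (1 - a) * Gamma (1 - a) := by
      rw [← Gamma_add_one h1a.ne']; ring_nf
    have := (Gamma_pos_of_pos h1a).ne'
    simp only [hW, intervalIntegral.integral_same, ProbabilityTheory.beta, hG]
    field_simp
    ring

/-- The one-sided power kernel `(u - t)₊ ^ a`. -/
noncomputable def powerKernel (a t u : ℝ) : ℝ :=
  if t < u then (u - t) ^ a else 0

theorem powerKernel_add_right (a t c u : ℝ) :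
    powerKernel a (t + c) u = powerKernel a t (u - c) := by
  simp only [powerKernel, lt_sub_iff_add_lt, sub_sub, add_comm]

theorem powerKernel_mul {r : ℝ} (hr : 0 < r) (a t u : ℝ) :
    powerKernel a (r * t) (r * u) = r ^ a * powerKernel a t u := by
  simp only [powerKernel, mul_lt_mul_iff_right₀ hr]
  split_ifs with h
  · rw [← mul_sub, mul_rpow hr.le (sub_nonneg.2 h.le)]
  · simp

/-- The variance at time `1` of the Mandelbrot–Van Ness integral with unit constant. -/
noncomputable def powerKernelVariance (a : ℝ) : ℝ :=
  Gamma (a + 1) * Gamma (1 - 2 * a) / ((2 * a + 1) * Gamma (1 - a))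

theorem powerKernelVariance_pos {a : ℝ} (ha : -(1 / 2) < a) (ha' : a < 1 / 2) :
    0 < powerKernelVariance a := by
  have h1 := Gamma_pos_of_pos (show 0 < a + 1 by linarith)
  have h2 := Gamma_pos_of_pos (show 0 < 1 - 2 * a by linarith)
  have h3 := Gamma_pos_of_pos (show 0 < 1 - a by linarith)
  have h4 : 0 < 2 * a + 1 := by linarith
  unfold powerKernelVariance
  positivity

theorem powerKernel_sub_sq_unit {a : ℝ} (ha : -(1 / 2) < a) (ha' : a < 1 / 2) :
    Integrable (fun u => (powerKernel a 0 u - powerKernel a 1 u) ^ 2) ∧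
    ∫ u, (powerKernel a 0 u - powerKernel a 1 u) ^ 2 = powerKernelVariance a := by
  obtain ⟨hi, hv⟩ := integrableOn_and_integral_rpow_sub_rpow_sq ha ha'
  have h2a : -1 < 2 * a := by linarith
  have hsplit : (fun u => (powerKernel a 0 u - powerKernel a 1 u) ^ 2) = fun u =>
      (Ioc (0 : ℝ) 1).indicator (fun u => u ^ (2 * a)) u +
      (Ioi (0 : ℝ)).indicator (fun s => ((1 + s) ^ a - s ^ a) ^ 2) (u - 1) := by
    ext u
    simp only [powerKernel, indicator, mem_Ioc, mem_Ioi, sub_pos, sub_zero]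
    by_cases h0 : 0 < u <;> by_cases h1 : 1 < u
    · simp [h0, h1]
    · simp only [h0, h1, if_true, if_false, not_lt.1 h1, and_self]
      rw [sub_zero, add_zero, ← rpow_mul_natCast h0.le]
      ring_nf
    · linarith
    · simp [h0, h1]
  have hi1 : IntegrableOn (fun u : ℝ => u ^ (2 * a)) (Ioc 0 1) := by
    rw [← intervalIntegrable_iff_integrableOn_Ioc_of_le zero_le_one]
    exact intervalIntegral.intervalIntegrable_rpow' h2a
  have hv1 : ∫ u in Ioc (0 : ℝ) 1, u ^ (2 * a) = 1 / (2 * a + 1) := by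
    rw [← intervalIntegral.integral_of_le zero_le_one, integral_rpow (Or.inl h2a), one_rpow,
      zero_rpow (by linarith), sub_zero]
  have hj1 := hi1.integrable_indicator measurableSet_Ioc
  have hj2 := (hi.integrable_indicator measurableSet_Ioi).comp_sub_right 1
  rw [hsplit]
  refine ⟨hj1.add hj2, ?_⟩
  rw [integral_add hj1 hj2, integral_indicator measurableSet_Ioc, hv1,
    integral_sub_right_eq_self ((Ioi (0 : ℝ)).indicator fun s : ℝ => ((1 + s) ^ a - s ^ a) ^ 2) 1,
    integral_indicator measurableSet_Ioi]
  have h3 : 2 * a + 1 ≠ 0 := by linarith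
  have h4 := (Gamma_pos_of_pos (show 0 < 1 - a by linarith)).ne'
  apply mul_left_cancel₀ h3
  rw [mul_add, hv, powerKernelVariance]
  field_simp
  ring

theorem powerKernel_sub_sq_of_lt {a : ℝ} (ha : -(1 / 2) < a) (ha' : a < 1 / 2) {s t : ℝ}
    (hst : s < t) :
    Integrable (fun u => (powerKernel a s u - powerKernel a t u) ^ 2) ∧
    ∫ u, (powerKernel a s u - powerKernel a t u) ^ 2 =
      powerKernelVariance a * (t - s) ^ (2 * a + 1) := by
  obtain ⟨hi, hv⟩ := powerKernel_sub_sq_unit ha ha'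
  have hr : 0 < t - s := sub_pos.2 hst
  set r := t - s with hrdef
  have hkey : (fun u => (powerKernel a s u - powerKernel a t u) ^ 2) = fun u =>
      (fun v => r ^ (2 * a) * (powerKernel a 0 (r⁻¹ * v) - powerKernel a 1 (r⁻¹ * v)) ^ 2)
        (u - s) := by
    ext u
    have e1 : powerKernel a s u = r ^ a * powerKernel a 0 (r⁻¹ * (u - s)) := by
      rw [← powerKernel_mul hr, mul_inv_cancel_left₀ hr.ne', mul_zero,
        ← powerKernel_add_right, zero_add]
    have e2 : powerKernel a t u = r ^ a * powerKernel a 1 (r⁻¹ * (u - s)) := by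
      rw [← powerKernel_mul hr, mul_inv_cancel_left₀ hr.ne', mul_one,
        ← powerKernel_add_right, hrdef, sub_add_cancel]
    rw [e1, e2, two_mul, rpow_add hr]
    ring
  have hi' := (hi.comp_mul_left' (inv_ne_zero hr.ne')).const_mul (r ^ (2 * a))
  rw [hkey]
  refine ⟨hi'.comp_sub_right s, ?_⟩
  rw [integral_sub_right_eq_self (fun v => r ^ (2 * a) *
      (powerKernel a 0 (r⁻¹ * v) - powerKernel a 1 (r⁻¹ * v)) ^ 2) s, integral_const_mul,
    Measure.integral_comp_mul_left
      (fun v => (powerKernel a 0 v - powerKernel a 1 v) ^ 2) r⁻¹, hv, inv_inv, abs_of_pos hr,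
    rpow_add_one hr.ne', smul_eq_mul]
  ring

theorem powerKernel_sub_sq {a : ℝ} (ha : -(1 / 2) < a) (ha' : a < 1 / 2) (s t : ℝ) :
    Integrable (fun u => (powerKernel a s u - powerKernel a t u) ^ 2) ∧
    ∫ u, (powerKernel a s u - powerKernel a t u) ^ 2 =
      powerKernelVariance a * |s - t| ^ (2 * a + 1) := by
  rcases lt_trichotomy s t with h | rfl | h
  · rw [abs_sub_comm, abs_of_pos (sub_pos.2 h)]
    exact powerKernel_sub_sq_of_lt ha ha' h
  · simp [zero_rpow (show 2 * a + 1 ≠ 0 by linarith)]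
  · rw [abs_of_pos (sub_pos.2 h)]
    simpa only [sub_sq_comm] using powerKernel_sub_sq_of_lt ha ha' h

/-- The kernel of the unit increment at time `t`. -/
noncomputable def incrementKernel (a t u : ℝ) : ℝ :=
  powerKernel a t u - powerKernel a (t + 1) u

theorem incrementKernel_mul {a : ℝ} (ha : -(1 / 2) < a) (ha' : a < 1 / 2) (s t : ℝ) :
    Integrable (fun u => incrementKernel a s u * incrementKernel a t u) ∧
    ∫ u, incrementKernel a s u * incrementKernel a t u = powerKernelVariance a *
      ((|s - t + 1| ^ (2 * a + 1) - 2 * |s - t| ^ (2 * a + 1) + |s - t - 1| ^ (2 * a + 1)) / 2) := by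
  have hpol : (fun u => incrementKernel a s u * incrementKernel a t u) = fun u =>
      ((powerKernel a s u - powerKernel a (t + 1) u) ^ 2 +
        (powerKernel a (s + 1) u - powerKernel a t u) ^ 2 -
        ((powerKernel a s u - powerKernel a t u) ^ 2 +
          (powerKernel a (s + 1) u - powerKernel a (t + 1) u) ^ 2)) / 2 := by
    ext u
    simp only [incrementKernel]
    ring
  have h1 := powerKernel_sub_sq ha ha' s (t + 1)
  have h2 := powerKernel_sub_sq ha ha' (s + 1) t
  have h3 := powerKernel_sub_sq ha ha' s t
  have h4 := powerKernel_sub_sq ha ha' (s + 1) (t + 1)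
  rw [hpol]
  refine ⟨((h1.1.add h2.1).sub (h3.1.add h4.1)).div_const 2, ?_⟩
  rw [integral_div, integral_sub (by exact h1.1.add h2.1) (by exact h3.1.add h4.1),
    integral_add h1.1 h2.1, integral_add h3.1 h4.1, h1.2, h2.2, h3.2, h4.2,
    show s - (t + 1) = s - t - 1 by ring,
    show s + 1 - t = s - t + 1 by ring, show s + 1 - (t + 1) = s - t by ring]
  ring

theorem fgnRho_dist {H : ℝ} (hH : 0 < H) (i j : ℕ) :
    fgnRho H (Nat.dist i j) = (|(i : ℝ) - j + 1| ^ (2 * H) - 2 * |(i : ℝ) - j| ^ (2 * H) +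
      |(i : ℝ) - j - 1| ^ (2 * H)) / 2 := by
  wlog h : j ≤ i generalizing i j
  · rw [Nat.dist_comm, this j i (le_of_not_ge h), abs_sub_comm (j : ℝ) i,
      ← abs_neg ((j : ℝ) - i + 1), ← abs_neg ((j : ℝ) - i - 1),
      show -((j : ℝ) - i + 1) = i - j - 1 by ring, show -((j : ℝ) - i - 1) = i - j + 1 by ring]
    ring
  · obtain ⟨k, rfl⟩ := Nat.exists_eq_add_of_le h
    rw [Nat.dist_eq_sub_of_le_right h, Nat.add_sub_cancel_left, Nat.cast_add, add_sub_cancel_left]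
    rcases Nat.eq_zero_or_pos k with rfl | hk
    · simp [fgnRho, zero_rpow (show 2 * H ≠ 0 by linarith)]
    · have hk' : (1 : ℝ) ≤ k := by exact_mod_cast hk
      rw [fgnRho, if_neg hk.ne', abs_of_nonneg (by linarith), abs_of_nonneg (by linarith),
        abs_of_nonneg (by linarith)]

theorem mul_fgnCov_apply {H : ℝ} (hH : H ∈ Ioo (0 : ℝ) 1) {n : ℕ} (i j : Fin n) :
    powerKernelVariance (H - 1 / 2) * fgnCov H n i j =
      ∫ u, incrementKernel (H - 1 / 2) i u * incrementKernel (H - 1 / 2) j u := by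
  rw [(incrementKernel_mul (by linarith [hH.1]) (by linarith [hH.2]) _ _).2,
    show 2 * (H - 1 / 2) + 1 = 2 * H by ring, fgnCov, of_apply, fgnRho_dist hH.1]

theorem mul_dotProduct_fgnCov_mulVec {H : ℝ} (hH : H ∈ Ioo (0 : ℝ) 1) {n : ℕ} (x : Fin n → ℝ) :
    Integrable (fun u => (∑ i, x i * incrementKernel (H - 1 / 2) i u) ^ 2) ∧
    powerKernelVariance (H - 1 / 2) * (x ⬝ᵥ fgnCov H n *ᵥ x) =
      ∫ u, (∑ i, x i * incrementKernel (H - 1 / 2) i u) ^ 2 := by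
  have hi (i j : Fin n) := (incrementKernel_mul (a := H - 1 / 2) (by linarith [hH.1])
    (by linarith [hH.2]) i j).1
  have hexp : (fun u => (∑ i, x i * incrementKernel (H - 1 / 2) i u) ^ 2) = fun u =>
      ∑ i, ∑ j, x i * x j *
        (incrementKernel (H - 1 / 2) (i : Fin n) u * incrementKernel (H - 1 / 2) (j : Fin n) u) := by
    ext u
    rw [sq, Finset.sum_mul_sum]
    refine Finset.sum_congr rfl fun i _ => Finset.sum_congr rfl fun j _ => ?_
    ring
  rw [hexp]
  have hs (i j : Fin n) := (hi i j).const_mul (x i * x j)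
  refine ⟨integrable_finsetSum _ fun i _ => integrable_finsetSum _ fun j _ => hs i j, ?_⟩
  rw [integral_finsetSum _ fun i _ => integrable_finsetSum _ fun j _ => hs i j]
  simp_rw [integral_finsetSum _ fun j _ => hs _ j, integral_const_mul, ← mul_fgnCov_apply hH]
  simp only [dotProduct, mulVec, Finset.mul_sum]
  refine Finset.sum_congr rfl fun i _ => Finset.sum_congr rfl fun j _ => ?_
  ring

theorem fgnSigmaSq_mul_powerKernelVariance {H : ℝ} (hH : H ∈ Ioo (0 : ℝ) 1) :
    fgnSigmaSq H * powerKernelVariance (H - 1 / 2) = 1 / (2 * H) := by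
  have h0 : H ≠ 0 := hH.1.ne'
  have h1 := (Gamma_pos_of_pos (show 0 < 3 / 2 - H by linarith [hH.2])).ne'
  have h2 := (Gamma_pos_of_pos (show 0 < H + 1 / 2 by linarith [hH.1])).ne'
  have h3 := (Gamma_pos_of_pos (show 0 < 2 - 2 * H by linarith [hH.2])).ne'
  rw [fgnSigmaSq, powerKernelVariance, show H - 1 / 2 + 1 = H + 1 / 2 by ring,
    show 1 - 2 * (H - 1 / 2) = 2 - 2 * H by ring, show 1 - (H - 1 / 2) = 3 / 2 - H by ring,
    show 2 * (H - 1 / 2) + 1 = 2 * H by ring]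
  generalize Gamma (3 / 2 - H) = x at *
  generalize Gamma (H + 1 / 2) = y at *
  generalize Gamma (2 - 2 * H) = z at *
  field_simp

theorem fgnSigmaSq_pos {H : ℝ} (hH : H ∈ Ioo (0 : ℝ) 1) : 0 < fgnSigmaSq H :=
  div_pos (Gamma_pos_of_pos (by linarith [hH.2]))
    (mul_pos (Gamma_pos_of_pos (by linarith [hH.1])) (Gamma_pos_of_pos (by linarith [hH.2])))

theorem sum_mul_incrementKernel_eq {a : ℝ} {n : ℕ} (x : Fin (n + 1) → ℝ) {u : ℝ}
    (hu : u ∈ Ioc (0 : ℝ) 1) :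
    (∑ i, x i * incrementKernel a i u) ^ 2 = x 0 ^ 2 * u ^ (2 * a) := by
  rw [Finset.sum_eq_single 0]
  · have h1 : ¬ (1 : ℝ) < u := not_lt.2 hu.2
    simp only [incrementKernel, powerKernel, Fin.val_zero, Nat.cast_zero, zero_add, hu.1, if_true,
      h1, if_false, sub_zero, two_mul, rpow_add hu.1]
    ring
  · intro i _ hi
    have h1 : (1 : ℝ) ≤ (i : ℕ) := by
      exact_mod_cast Nat.one_le_iff_ne_zero.2 (Fin.val_ne_zero_iff.2 hi)
    rw [incrementKernel, powerKernel, powerKernel, if_neg (by linarith [hu.2]),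
      if_neg (by linarith [hu.2]), sub_zero, mul_zero]
  · simp

/-- The one-step prediction variance of fractional Gaussian noise is at least `fgnSigmaSq H`. -/
theorem fgnSigmaSq_mul_sq_le {H : ℝ} (hH : H ∈ Ioo (0 : ℝ) 1) {n : ℕ} (x : Fin (n + 1) → ℝ) :
    fgnSigmaSq H * x 0 ^ 2 ≤ x ⬝ᵥ fgnCov H (n + 1) *ᵥ x := by
  have hV := powerKernelVariance_pos (a := H - 1 / 2) (by linarith [hH.1]) (by linarith [hH.2])
  obtain ⟨hi, hv⟩ := mul_dotProduct_fgnCov_mulVec hH x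
  refine le_of_mul_le_mul_left ?_ hV
  rw [hv, mul_left_comm, ← mul_assoc, fgnSigmaSq_mul_powerKernelVariance hH]
  calc 1 / (2 * H) * x 0 ^ 2
      = ∫ u in Ioc (0 : ℝ) 1, (∑ i, x i * incrementKernel (H - 1 / 2) (i : Fin (n + 1)) u) ^ 2 := by
        rw [setIntegral_congr_fun measurableSet_Ioc fun u hu => sum_mul_incrementKernel_eq x hu,
          integral_const_mul, ← intervalIntegral.integral_of_le zero_le_one,
          integral_rpow (Or.inl (by linarith [hH.1])), one_rpow,
          show 2 * (H - 1 / 2) + 1 = 2 * H by ring, zero_rpow (by linarith [hH.1]), sub_zero,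
          mul_comm]
    _ ≤ _ := setIntegral_le_integral hi (ae_of_all _ fun u => sq_nonneg _)

theorem fgnCov_submatrix_succ (H : ℝ) (n : ℕ) :
    (fgnCov H (n + 1)).submatrix Fin.succ Fin.succ = fgnCov H n := by
  ext i j
  simp [fgnCov, Nat.dist_succ_succ]

theorem fgnSigmaSq_pow_le_det_fgnCov {H : ℝ} (hH : H ∈ Ioo (0 : ℝ) 1) (n : ℕ) :
    fgnSigmaSq H ^ n ≤ (fgnCov H n).det := by
  induction n with
  | zero => simp
  | succ n ih =>
    have hσ := fgnSigmaSq_pos hH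
    have hd : 0 < (fgnCov H n).det := (pow_pos hσ n).trans_le ih
    set A := fgnCov H (n + 1) with hA
    have h0 : A.adjugate 0 0 = (fgnCov H n).det := by
      rw [adjugate_fin_succ_eq_det_submatrix, ← fgnCov_submatrix_succ]
      simp [hA, Fin.succAbove_zero]
    have hx : A *ᵥ (A.adjugate.col 0) = A.det • Pi.single 0 1 := by
      rw [← mulVec_single_one, mulVec_mulVec, mul_adjugate, smul_mulVec, one_mulVec]
    have h1 := fgnSigmaSq_mul_sq_le hH (A.adjugate.col 0)
    rw [← hA, hx, dotProduct_smul, dotProduct_single_one, col_apply, h0, smul_eq_mul, sq,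
      ← mul_assoc] at h1
    calc fgnSigmaSq H ^ (n + 1) = fgnSigmaSq H * fgnSigmaSq H ^ n := pow_succ' _ _
      _ ≤ fgnSigmaSq H * (fgnCov H n).det := mul_le_mul_of_nonneg_left ih hσ.le
      _ ≤ A.det := le_of_mul_le_mul_right h1 hd

end

/-- `det Σ_n(H) ≥ (σ²_H)^n`, and consequently the entropy
`H(G^H_1,…,G^H_n) = (n/2)(1 + log 2π) + (1/2) log det Σ_n(H)` is at least
`(n/2)(1 + log 2π + log σ²_H)`. -/
theorem fgn_entropy_lower_bound (H : ℝ) (hH : H ∈ Set.Ioo (0 : ℝ) 1)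
    (n : ℕ) (hn : 1 ≤ n) :
    fgnSigmaSq H ^ n ≤ (fgnCov H n).det ∧
    ((n : ℝ) / 2) * (1 + Real.log (2 * π) + Real.log (fgnSigmaSq H)) ≤
      ((n : ℝ) / 2) * (1 + Real.log (2 * π)) + (1 / 2) * Real.log (fgnCov H n).det := by
  have hdet := fgnSigmaSq_pow_le_det_fgnCov hH n
  have hσ := fgnSigmaSq_pos hH
  refine ⟨hdet, ?_⟩
  have hlog := Real.log_le_log (pow_pos hσ n) hdet
  rw [Real.log_pow] at hlog
  linarith
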